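/- arXiv:1511.08287 — 3 statements merged into one kernel-verified Lean document; each statement's English description precedes it below -/
import Mathlib

section
/- Let K be a field. Every quasi-isomorphism f : C → D between ℤ-indexed cochain complexes of K-vector spaces is a homotopy equivalence, i.e., there exists a chain map g : D → C such that g ∘ f is chain homotopic to the identity of C and f ∘ g is chain homotopic to the identity of D. -/
open CategoryTheory Limits

/-- Every linear map between vector spaces has a generalized inverse. -/
lemma LinearMap.exists_comp_comp_eq_self {K V W : Type*} [DivisionRing K] [AddCommGroup V]
    [Module K V] [AddCommGroup W] [Module K W] (f : V →ₗ[K] W) :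
    ∃ g : W →ₗ[K] V, f ∘ₗ g ∘ₗ f = f := by
  obtain ⟨s, hs⟩ := f.rangeRestrict.exists_rightInverse_of_surjective f.range_rangeRestrict
  obtain ⟨p, hp⟩ := (LinearMap.range f).subtype.exists_leftInverse_of_injective
    (LinearMap.range f).ker_subtype
  refine ⟨s ∘ₗ p, LinearMap.ext fun x ↦ ?_⟩
  have h₁ : p (f x) = f.rangeRestrict x := LinearMap.congr_fun hp (f.rangeRestrict x)
  have h₂ := congr_arg Subtype.val (LinearMap.congr_fun hs (f.rangeRestrict x))
  simpa [h₁] using h₂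

namespace CochainComplex

variable {K : Type*} [DivisionRing K]

/-- An acyclic cochain complex of vector spaces is contractible. -/
lemma nonempty_homotopy_id_zero_of_acyclic {L : CochainComplex (ModuleCat K) ℤ}
    (hL : L.Acyclic) : Nonempty (Homotopy (𝟙 L) 0) := by
  choose t ht using fun i j ↦ (L.d j i).hom.exists_comp_comp_eq_self
  let h (i j : ℤ) : L.X i ⟶ L.X j :=
    ModuleCat.ofHom (t i j - (L.d (j - 1) j).hom ∘ₗ t j (j - 1) ∘ₗ t i j)
  suffices 𝟙 L = Homotopy.nullHomotopicMap' fun i j _ ↦ h i j from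
    ⟨(Homotopy.ofEq this).trans (Homotopy.nullHomotopy' _)⟩
  ext j x
  rw [Homotopy.nullHomotopicMap'_f (show (ComplexShape.up ℤ).Rel (j - 1) j by simp)
    (show (ComplexShape.up ℤ).Rel j (j + 1) by simp)]
  have ht' (i j : ℤ) (y : L.X j) : L.d j i (t i j (L.d j i y)) = L.d j i y :=
    LinearMap.congr_fun (ht i j) y
  have hd (i j k : ℤ) (y : L.X i) : L.d j k (L.d i j y) = 0 := by
    rw [← ConcreteCategory.comp_apply, L.d_comp_d]
    rfl
  have hex := (L.exactAt_iff' (j - 1) j (j + 1) (by simp) (by simp)).1 (hL j)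
  rw [ShortComplex.moduleCat_exact_iff] at hex
  obtain ⟨y, hy⟩ := hex (x - t (j + 1) j (L.d j (j + 1) x))
    ((map_sub (L.d j (j + 1)).hom _ _).trans (sub_eq_zero.2 (ht' _ _ _).symm))
  replace hy : L.d (j - 1) j y = x - t (j + 1) j (L.d j (j + 1) x) := hy
  have hu := ht' j (j - 1) y
  rw [hy] at hu
  simp only [map_sub] at hu
  simp [h, hd]
  grind

/-- Every cochain complex of vector spaces is K-projective. -/
instance isKProjective_of_divisionRing (C : CochainComplex (ModuleCat K) ℤ) :
    C.IsKProjective where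
  nonempty_homotopy_zero f hL :=
    (nonempty_homotopy_id_zero_of_acyclic hL).map fun h ↦
      (Homotopy.ofEq (by simp)).trans ((h.compLeft f).trans (.ofEq (by simp)))

end CochainComplex

/-- Over a field `K`, every quasi-isomorphism of `ℤ`-indexed cochain
complexes of `K`-vector spaces is a homotopy equivalence: there is a chain map `g`
in the opposite direction such that both composites are homotopic to the identity. -/
theorem quasiIso_over_field_is_homotopyEquiv
    {K : Type u} [Field K] {C D : CochainComplex (ModuleCat.{u} K) ℤ}
    (f : C ⟶ D) (hf : QuasiIso f) :
    ∃ g : D ⟶ C,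
      Nonempty (Homotopy (f ≫ g) (𝟙 C)) ∧ Nonempty (Homotopy (g ≫ f) (𝟙 D)) := by
  obtain ⟨e, rfl⟩ := (CochainComplex.IsKProjective.quasiIso_iff f).1 hf
  exact ⟨e.inv, ⟨e.homotopyHomInvId⟩, ⟨e.homotopyInvHomId⟩⟩
end

section
/- Let A be a cocomplete symmetric monoidal abelian category such that: the tensor product is exact separately in each variable (for each object X, the functors X ⊗ (−) and (−) ⊗ X preserve finite limits and finite colimits); the tensor product preserves all small colimits separately in each variable; and filtered colimits in A are exact (commute with finite limits). Then for every ℤ-indexed cochain complex K in A and every acyclic ℤ-indexed cochain complex L in A, the tensor product complex K ⊗ L is acyclic. -/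
open CategoryTheory Limits MonoidalCategory

namespace CategoryTheory

/-- A short complex of functors to an abelian category is exact if it is objectwise exact. -/
lemma ShortComplex.exact_of_exact_evaluation {J C : Type*} [Category* J] [Category* C] [Abelian C]
    (S : ShortComplex (J ⥤ C)) (h : ∀ j, (S.map ((evaluation J C).obj j)).Exact) :
    S.Exact := by
  rw [ShortComplex.exact_iff_isZero_homology]
  refine Functor.isZero _ fun j ↦ ?_
  exact ((ShortComplex.exact_iff_isZero_homology _).1 (h j)).of_iso
    (S.mapHomologyIso ((evaluation J C).obj j)).symm

/-- Multiplying both maps of an exact short complex by the same sign preserves exactness. -/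
lemma ShortComplex.Exact.units_smul {C : Type*} [Category* C] [Preadditive C]
    {X₁ X₂ X₃ : C} {f : X₁ ⟶ X₂} {g : X₂ ⟶ X₃} {w : f ≫ g = 0}
    (h : (ShortComplex.mk f g w).Exact) (ε : ℤˣ) :
    (ShortComplex.mk (ε • f) (ε • g)
      (by simp [Linear.units_smul_comp, Linear.comp_units_smul, w])).Exact := by
  refine ShortComplex.exact_of_iso ?_ h
  refine ShortComplex.isoMk (Iso.refl _)
    { hom := ε • 𝟙 _
      inv := ε • 𝟙 _
      hom_inv_id := by simp [Linear.comp_units_smul, smul_smul]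
      inv_hom_id := by simp [Linear.comp_units_smul, smul_smul] }
    (Iso.refl _) ?_ ?_
  · simp [Linear.comp_units_smul]
  · simp [Linear.units_smul_comp, Linear.comp_units_smul, smul_smul]

lemma ShortComplex.map_app_comp_map_app {C₁ C₂ D : Type*} [Category* C₁] [Category* C₂]
    [Category* D] [HasZeroMorphisms C₁] [HasZeroMorphisms D] (S : ShortComplex C₁)
    (F : C₁ ⥤ C₂ ⥤ D) [F.PreservesZeroMorphisms] (Y : C₂) :
    (F.map S.f).app Y ≫ (F.map S.g).app Y = 0 := by
  rw [← NatTrans.comp_app, ← F.map_comp, S.zero, F.map_zero, zero_app]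

end CategoryTheory

namespace CochainComplex

variable {C : Type*} [Category* C] [Abelian C] (K : CochainComplex C ℤ)

/-- The cycles of a cochain complex, as a complex with zero differentials. -/
noncomputable def cyclesComplex : CochainComplex C ℤ where
  X p := K.cycles p
  d _ _ := 0

/-- The quotients of the terms of a cochain complex by their cycles, as a complex
with zero differentials. -/
noncomputable def modCyclesComplex : CochainComplex C ℤ where
  X p := cokernel (K.iCycles p)
  d _ _ := 0

lemma d_comp_cokernel_π_iCycles (i j : ℤ) : K.d i j ≫ cokernel.π (K.iCycles j) = 0 := by
  rw [← K.toCycles_i i j, Category.assoc, cokernel.condition, comp_zero]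

/-- The short complex formed by the cycles of a cochain complex, the complex itself, and
the quotient by the cycles. -/
@[simps]
noncomputable def cyclesShortComplex : ShortComplex (CochainComplex C ℤ) where
  X₁ := K.cyclesComplex
  X₂ := K
  X₃ := K.modCyclesComplex
  f :=
    { f p := K.iCycles p
      comm' i j _ := by simp [cyclesComplex] }
  g :=
    { f p := cokernel.π (K.iCycles p)
      comm' i j _ := comp_zero.trans (K.d_comp_cokernel_π_iCycles i j).symm }
  zero := by
    ext p
    exact cokernel.condition (K.iCycles p)

lemma shortExact_cyclesShortComplex : K.cyclesShortComplex.ShortExact :=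
  HomologicalComplex.shortExact_of_degreewise_shortExact _ fun p ↦
    { exact := ShortComplex.exact_cokernel (K.iCycles p)
      mono_f := inferInstanceAs (Mono (K.iCycles p))
      epi_g := inferInstanceAs (Epi (cokernel.π (K.iCycles p))) }

end CochainComplex

namespace HomologicalComplex

variable {C₁ C₂ D : Type*} [Category* C₁] [Category* C₂] [Category* D]
  [Abelian C₁] [Abelian C₂] [Abelian D] (F : C₁ ⥤ C₂ ⥤ D)
  [F.PreservesZeroMorphisms] [∀ X, (F.obj X).PreservesZeroMorphisms]
  [∀ (K : CochainComplex C₁ ℤ) (L : CochainComplex C₂ ℤ),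
    HasMapBifunctor K L F (ComplexShape.up ℤ)]

/-- The summands `F(K^p, L^(n-p))` of the degree `n` term of the total complex. -/
abbrev mapBifunctorSummand (K : CochainComplex C₁ ℤ) (L : CochainComplex C₂ ℤ) (n : ℤ) :
    Discrete ℤ ⥤ D :=
  Discrete.functor fun p ↦ (F.obj (K.X p)).obj (L.X (n - p))

/-- The degree `n` term of the total complex, as a cofan over its summands. -/
noncomputable abbrev mapBifunctorCofan (K : CochainComplex C₁ ℤ) (L : CochainComplex C₂ ℤ)
    (n : ℤ) : Cofan fun p ↦ (F.obj (K.X p)).obj (L.X (n - p)) :=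
  Cofan.mk ((mapBifunctor K L F (ComplexShape.up ℤ)).X n) fun p ↦
    ιMapBifunctor K L F (ComplexShape.up ℤ) p (n - p) n (add_sub_cancel p n)

/-- The degree `n` term of the total complex is the coproduct of its summands. -/
noncomputable def isColimitMapBifunctorCofan (K : CochainComplex C₁ ℤ)
    (L : CochainComplex C₂ ℤ) (n : ℤ) : IsColimit (mapBifunctorCofan F K L n) :=
  Cofan.IsColimit.mk _
    (fun s ↦ mapBifunctorDesc fun p q h ↦
      eqToHom (by
        obtain rfl : q = n - p := eq_sub_of_add_eq' h
        rfl) ≫ s.inj p)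
    (fun s p ↦ by simp)
    (fun s m hm ↦ by
      refine mapBifunctor.hom_ext fun p q h ↦ ?_
      obtain rfl : q = n - p := eq_sub_of_add_eq' h
      simpa using hm p)

variable {F}

/-- The total complex is acyclic when the first complex has zero differentials and the
second one is acyclic. -/
lemma acyclic_mapBifunctor_of_d_eq_zero [HasColimitsOfShape (Discrete ℤ) D]
    [HasExactColimitsOfShape (Discrete ℤ) D]
    [∀ X, PreservesFiniteLimits (F.obj X)] [∀ X, PreservesFiniteColimits (F.obj X)]
    (K : CochainComplex C₁ ℤ) (L : CochainComplex C₂ ℤ) (hK : ∀ i j, K.d i j = 0)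
    (hL : L.Acyclic) : (mapBifunctor K L F (ComplexShape.up ℤ)).Acyclic := by
  intro n
  rw [exactAt_iff' _ (n - 1) n (n + 1) (by simp) (by simp)]
  let φ (i j : ℤ) : mapBifunctorSummand F K L i ⟶ mapBifunctorSummand F K L j :=
    Discrete.natTrans fun ⟨p⟩ ↦
      p.negOnePow • (F.obj (K.X p)).map (L.d (i - p) (j - p))
  have hd (i j p : ℤ) (hij : i + 1 = j) :
      ιMapBifunctor K L F (ComplexShape.up ℤ) p (i - p) i (add_sub_cancel p i) ≫
        (mapBifunctor K L F (ComplexShape.up ℤ)).d i j =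
      (p.negOnePow • (F.obj (K.X p)).map (L.d (i - p) (j - p))) ≫
        ιMapBifunctor K L F (ComplexShape.up ℤ) p (j - p) j (add_sub_cancel p j) := by
    rw [mapBifunctor.d_eq, Preadditive.comp_add, mapBifunctor.ι_D₁, mapBifunctor.ι_D₂,
      mapBifunctor.d₁_eq' K L F _ (show (ComplexShape.up ℤ).Rel p (p + 1) from rfl),
      mapBifunctor.d₂_eq K L F _ p
        (show (ComplexShape.up ℤ).Rel (i - p) (j - p) by simp; lia) _ (add_sub_cancel p j),
      hK, F.map_zero, Linear.units_smul_comp]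
    simp
  let S : ShortComplex (Discrete ℤ ⥤ D) := ShortComplex.mk (φ (n - 1) n) (φ n (n + 1)) (by
    ext ⟨p⟩
    simp [φ, Linear.units_smul_comp, Linear.comp_units_smul, ← Functor.map_comp])
  have hS : S.Exact := by
    refine S.exact_of_exact_evaluation fun ⟨p⟩ ↦ ?_
    have h := (exactAt_iff' L (n - 1 - p) (n - p) (n + 1 - p) (by simp; lia)
      (by simp; lia)).1 (hL (n - p))
    exact (h.map (F.obj (K.X p))).units_smul p.negOnePow
  exact colim.exact_mapShortComplex hS (isColimitMapBifunctorCofan F K L (n - 1))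
    (isColimitMapBifunctorCofan F K L n) (isColimitMapBifunctorCofan F K L (n + 1))
    _ _ (fun ⟨p⟩ ↦ hd _ _ p (by lia)) (fun ⟨p⟩ ↦ hd _ _ p (by lia))

/-- Forming the total complex with a fixed second argument preserves short exact sequences. -/
lemma shortExact_mapBifunctorMap [HasColimitsOfShape (Discrete ℤ) D]
    [HasExactColimitsOfShape (Discrete ℤ) D]
    [∀ Y, PreservesFiniteLimits (F.flip.obj Y)] [∀ Y, PreservesFiniteColimits (F.flip.obj Y)]
    {S : ShortComplex (CochainComplex C₁ ℤ)} (hS : S.ShortExact) (L : CochainComplex C₂ ℤ) :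
    (ShortComplex.mk (mapBifunctorMap S.f (𝟙 L) F (ComplexShape.up ℤ))
      (mapBifunctorMap S.g (𝟙 L) F (ComplexShape.up ℤ)) (by
        ext n p q h
        have w : (F.map (S.f.f p)).app (L.X q) ≫ (F.map (S.g.f p)).app (L.X q) = 0 :=
          (S.map (HomologicalComplex.eval _ _ p)).map_app_comp_map_app F (L.X q)
        simpa using w =≫ ιMapBifunctor S.X₃ L F (ComplexShape.up ℤ) p q n h)).ShortExact := by
  refine HomologicalComplex.shortExact_of_degreewise_shortExact _ fun n ↦ ?_
  let φ {K K' : CochainComplex C₁ ℤ} (f : K ⟶ K') :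
      mapBifunctorSummand F K L n ⟶ mapBifunctorSummand F K' L n :=
    Discrete.natTrans fun ⟨p⟩ ↦ (F.map (f.f p)).app (L.X (n - p))
  let T : ShortComplex (Discrete ℤ ⥤ D) := ShortComplex.mk (φ S.f) (φ S.g) (by
    ext ⟨p⟩
    exact (S.map (HomologicalComplex.eval _ _ p)).map_app_comp_map_app F (L.X (n - p)))
  have hT (p : ℤ) : (T.map ((evaluation _ _).obj ⟨p⟩)).ShortExact :=
    (hS.map_of_exact (HomologicalComplex.eval _ _ p)).map_of_exact (F.flip.obj (L.X (n - p)))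
  have hφ {K K' : CochainComplex C₁ ℤ} (f : K ⟶ K') (j : Discrete ℤ) :
      (mapBifunctorCofan F K L n).ι.app j ≫
        (mapBifunctorMap f (𝟙 L) F (ComplexShape.up ℤ)).f n =
      (φ f).app j ≫ (mapBifunctorCofan F K' L n).ι.app j := by
    simp [φ]
  have (j : Discrete ℤ) : Mono (T.f.app j) := (hT j.as).mono_f
  have : Mono T.f := NatTrans.mono_of_mono_app _
  have (j : Discrete ℤ) : Epi (T.g.app j) := (hT j.as).epi_g
  exact
    { exact := colim.exact_mapShortComplex
        (T.exact_of_exact_evaluation fun j ↦ (hT j.as).exact)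
        (isColimitMapBifunctorCofan F S.X₁ L n) (isColimitMapBifunctorCofan F S.X₂ L n)
        (isColimitMapBifunctorCofan F S.X₃ L n) _ _ (hφ S.f) (hφ S.g)
      mono_f := colim.map_mono' T.f (isColimitMapBifunctorCofan F S.X₁ L n)
        (isColimitMapBifunctorCofan F S.X₂ L n) _ (hφ S.f)
      epi_g := colim.map_epi' T.g (mapBifunctorCofan F S.X₂ L n)
        (isColimitMapBifunctorCofan F S.X₃ L n) _ (hφ S.g) }

/-- If a bifunctor is exact in each variable and countable coproducts are exact in its target,
then the total complex is acyclic as soon as the second complex is acyclic. -/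
theorem acyclic_mapBifunctor [HasColimitsOfShape (Discrete ℤ) D]
    [HasExactColimitsOfShape (Discrete ℤ) D]
    [∀ X, PreservesFiniteLimits (F.obj X)] [∀ X, PreservesFiniteColimits (F.obj X)]
    [∀ Y, PreservesFiniteLimits (F.flip.obj Y)] [∀ Y, PreservesFiniteColimits (F.flip.obj Y)]
    (K : CochainComplex C₁ ℤ) (L : CochainComplex C₂ ℤ) (hL : L.Acyclic) :
    (mapBifunctor K L F (ComplexShape.up ℤ)).Acyclic := by
  intro n
  rw [exactAt_iff_isZero_homology]
  refine ((shortExact_mapBifunctorMap (F := F)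
    K.shortExact_cyclesShortComplex L).homology_exact₂ n).isZero_of_both_zeros
      (IsZero.eq_of_src ?_ _ _) (IsZero.eq_of_tgt ?_ _ _)
  · exact (acyclic_mapBifunctor_of_d_eq_zero K.cyclesComplex L (fun _ _ ↦ rfl)
      hL n).isZero_homology
  · exact (acyclic_mapBifunctor_of_d_eq_zero K.modCyclesComplex L (fun _ _ ↦ rfl)
      hL n).isZero_homology

end HomologicalComplex

/-- Let `A` be a cocomplete symmetric monoidal abelian category such
that the tensor product is exact separately in each variable, the tensor product
preserves all small colimits separately in each variable, and filtered colimits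
in `A` are exact (AB5). Then for every `ℤ`-indexed cochain complex `K` and every
acyclic `ℤ`-indexed cochain complex `L` in `A`, the tensor product complex
`K ⊗ L` (the total complex `HomologicalComplex.tensorObj K L`) is acyclic. -/
theorem tensorObj_acyclic_of_acyclic
    {A : Type u} [Category.{v} A] [Abelian A] [MonoidalCategory A] [SymmetricCategory A]
    [HasColimits A]
    [(curriedTensor A).Additive] [∀ (X : A), ((curriedTensor A).obj X).Additive]
    [∀ (X : A), ((curriedTensor A).flip.obj X).Additive]
    [∀ (X : A), PreservesFiniteLimits ((curriedTensor A).obj X)]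
    [∀ (X : A), PreservesFiniteColimits ((curriedTensor A).obj X)]
    [∀ (X : A), PreservesFiniteLimits ((curriedTensor A).flip.obj X)]
    [∀ (X : A), PreservesFiniteColimits ((curriedTensor A).flip.obj X)]
    [∀ (X : A), PreservesColimits ((curriedTensor A).obj X)]
    [∀ (X : A), PreservesColimits ((curriedTensor A).flip.obj X)]
    [HasFilteredColimits A] [AB5 A]
    (K L : CochainComplex A ℤ)
    (hL : ∀ n : ℤ, IsZero (L.homology n)) :
    ∀ n : ℤ, IsZero ((HomologicalComplex.tensorObj K L).homology n) := by
  have : HasFiniteBiproducts A := Abelian.hasFiniteBiproducts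
  have : AB4OfSize.{v} A := AB4.of_AB5 A
  have : HasCoproducts.{0} A := hasCoproducts_shrink.{0, v}
  have : HasExactColimitsOfShape (Discrete ℤ) A :=
    HasExactColimitsOfShape.of_domain_equivalence A
      (Discrete.equivalence Equiv.ulift : Discrete (ULift.{v} ℤ) ≌ Discrete ℤ)
  exact fun n ↦ (HomologicalComplex.acyclic_mapBifunctor (F := curriedTensor A) K L
    fun i ↦ (L.exactAt_iff_isZero_homology i).2 (hL i)) n |>.isZero_homology
end

section
/- Let R be a commutative Noetherian ring, M a finitely generated R-module, and d a natural number. Suppose that for every finitely generated R-module B and every natural number n > d, the Ext group Ext^n_R(M, B) vanishes. Then for every R-module B and every natural number n > d, Ext^n_R(M, B) vanishes. -/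
open CategoryTheory Limits

namespace CategoryTheory.ProjectiveResolution

variable {C : Type*} [Category* C] [Abelian C] {X : C} (P : ProjectiveResolution X)

theorem isZero_ext_succ_iff {R : Type*} [CommRing R] [Linear R C] [EnoughProjectives C]
    (n : ℕ) (Y : C) :
    IsZero (((Ext R C (n + 1)).obj (Opposite.op X)).obj Y) ↔
      ∀ f : P.complex.X (n + 1) ⟶ Y, P.complex.d (n + 2) (n + 1) ≫ f = 0 →
        ∃ g : P.complex.X n ⟶ Y, P.complex.d (n + 1) n ≫ g = f := by
  rw [(P.isoExt (R := R) (n + 1) Y).isZero_iff, ← HomologicalComplex.exactAt_iff_isZero_homology,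
    HomologicalComplex.exactAt_iff' _ n (n + 1) (n + 2) (by simp) (by simp),
    ShortComplex.moduleCat_exact_iff]
  rfl

theorem subsingleton_abelianExt_succ_iff [HasExt.{w} C] (n : ℕ) (Y : C) :
    Subsingleton (Abelian.Ext X Y (n + 1)) ↔
      ∀ f : P.complex.X (n + 1) ⟶ Y, P.complex.d (n + 2) (n + 1) ≫ f = 0 →
        ∃ g : P.complex.X n ⟶ Y, P.complex.d (n + 1) n ≫ g = f := by
  refine ⟨fun _ f hf ↦ (P.extMk_eq_zero_iff f (n + 2) rfl hf n rfl).1 (Subsingleton.elim _ _),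
    fun h ↦ subsingleton_of_forall_eq 0 fun x ↦ ?_⟩
  obtain ⟨f, hf, rfl⟩ := P.extMk_surjective x (n + 2) rfl
  exact (P.extMk_eq_zero_iff f (n + 2) rfl hf n rfl).2 (h f hf)

end CategoryTheory.ProjectiveResolution

theorem CategoryTheory.isZero_ext_succ_iff_subsingleton_abelianExt
    {R : Type*} [CommRing R] {C : Type*} [Category* C] [Abelian C] [Linear R C]
    [EnoughProjectives C] [HasExt.{w} C] (X Y : C) (n : ℕ) :
    IsZero (((Ext R C (n + 1)).obj (Opposite.op X)).obj Y) ↔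
      Subsingleton (Abelian.Ext X Y (n + 1)) :=
  ((projectiveResolution X).isZero_ext_succ_iff n Y).trans
    ((projectiveResolution X).subsingleton_abelianExt_succ_iff n Y).symm

/-- Let `R` be a commutative Noetherian ring, `M` a finitely
generated `R`-module and `d : ℕ`. If `Ext^n_R(M, B) = 0` for every finitely
generated `R`-module `B` and every `n > d`, then `Ext^n_R(M, B) = 0` for every
`R`-module `B` and every `n > d`. -/
theorem ext_vanishing_of_ext_vanishing_on_fg
    {R : Type u} [CommRing R] [IsNoetherianRing R]
    (M : ModuleCat.{u} R) [Module.Finite R M] (d : ℕ)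
    (h : ∀ (B : ModuleCat.{u} R), Module.Finite R B →
      ∀ n : ℕ, d < n → IsZero (((Ext R (ModuleCat.{u} R) n).obj (Opposite.op M)).obj B)) :
    ∀ (B : ModuleCat.{u} R) (n : ℕ), d < n →
      IsZero (((Ext R (ModuleCat.{u} R) n).obj (Opposite.op M)).obj B) := by
  have : HasProjectiveDimensionLT M (d + 1) :=
    ModuleCat.hasProjectiveDimensionLT_of_forall_finite M (d + 1) fun B hB ↦
      (isZero_ext_succ_iff_subsingleton_abelianExt M B d).1 (h B hB (d + 1) d.lt_succ_self)
  rintro B (_ | n) hn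
  · exact absurd hn d.not_lt_zero
  · exact (isZero_ext_succ_iff_subsingleton_abelianExt M B n).2
      (HasProjectiveDimensionLT.subsingleton M (d + 1) (n + 1) hn B)
end
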